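/- arXiv:1604.05192 — 2 statements merged into one kernel-verified Lean document; each statement's English description precedes it below -/
import Mathlib

section
/- There exist strongly left-c.e. reals α and β (reals whose binary expansions are characteristic functions of c.e. sets) such that α − β is neither a left-c.e. real nor a right-c.e. real. -/
open Filter

/-- A real is left-c.e. if it is the limit of an increasing computable sequence of rationals. -/
def LeftCE (α : ℝ) : Prop :=
  ∃ f : ℕ → ℚ, Computable f ∧ StrictMono f ∧
    Tendsto (fun n => (f n : ℝ)) atTop (nhds α)

/-- A real is right-c.e. if it is the limit of a decreasing computable sequence of rationals. -/
def RightCE (α : ℝ) : Prop :=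
  ∃ f : ℕ → ℚ, Computable f ∧ StrictAnti f ∧
    Tendsto (fun n => (f n : ℝ)) atTop (nhds α)

/-- A real is computable if a computable sequence of rationals approximates it with error `2⁻ⁿ`. -/
def ComputableReal (α : ℝ) : Prop :=
  ∃ f : ℕ → ℚ, Computable f ∧ ∀ n, |(f n : ℝ) - α| < (2 : ℝ)⁻¹ ^ n

/-- Martin-Löf randomness of a real, via interval Martin-Löf tests: a test is a computable
double sequence of rational intervals, where level `n` has total length at most `2⁻ⁿ`;
a random real escapes some level of every test. -/
def MLRandom (α : ℝ) : Prop :=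
  ∀ U : ℕ → ℕ → ℚ × ℚ, Computable₂ U →
    (∀ n : ℕ, ∑' i : ℕ, max (((U n i).2 : ℝ) - ((U n i).1 : ℝ)) 0 ≤ (2 : ℝ)⁻¹ ^ n) →
    ∃ n : ℕ, ∀ i : ℕ, ¬ (((U n i).1 : ℝ) < α ∧ α < ((U n i).2 : ℝ))

/-- A set of naturals is computably enumerable. -/
def CESet (A : Set ℕ) : Prop :=
  ∃ f : ℕ →. ℕ, Partrec f ∧ ∀ n, n ∈ A ↔ (f n).Dom

/-- The real in [0,1] whose binary expansion is the characteristic sequence of `A`. -/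
noncomputable def realOfSet (A : Set ℕ) : ℝ :=
  ∑' n : ℕ, Set.indicator A (fun n => (2 : ℝ)⁻¹ ^ (n + 1)) n

/-- A real is strongly left-c.e. if its binary expansion is the characteristic
sequence of a c.e. set of naturals. -/
def StronglyLeftCE (α : ℝ) : Prop :=
  ∃ A : Set ℕ, CESet A ∧ α = realOfSet A

open Encodable

section RatCode

/-- The basic (non-surjective) encoding of rationals. -/
def ratE (q : ℚ) : ℕ := @encode ℚ Rat.instEncodable q

theorem ratE_def (q : ℚ) : ratE q = Nat.pair (Equiv.intEquivNat q.num) q.den := by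
  cases q
  rfl

theorem ratE_inj : Function.Injective ratE := @encode_injective ℚ Rat.instEncodable

theorem intE_ofNat (n : ℕ) : Equiv.intEquivNat (Int.ofNat n) = 2 * n := rfl

theorem intE_negSucc (n : ℕ) : Equiv.intEquivNat (Int.negSucc n) = 2 * n + 1 := rfl

def inS (m : ℕ) : Prop :=
  0 < m.unpair.2 ∧ ∀ c < m.unpair.2 + 1,
    ((m.unpair.1 + 1) / 2) % c = 0 → m.unpair.2 % c = 0 → c = 1

theorem natAbs_intE (z : ℤ) : (Equiv.intEquivNat z + 1) / 2 = z.natAbs := by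
  cases z with
  | ofNat n => rw [intE_ofNat]; simp; omega
  | negSucc n => rw [intE_negSucc]; simp; omega

theorem coprime_iff_aux (x d : ℕ) (hd : 0 < d) :
    (∀ c < d + 1, x % c = 0 → d % c = 0 → c = 1) ↔ x.Coprime d := by
  constructor
  · intro h
    refine h _ ?_ (Nat.mod_eq_zero_of_dvd (Nat.gcd_dvd_left _ _))
      (Nat.mod_eq_zero_of_dvd (Nat.gcd_dvd_right _ _))
    exact Nat.lt_succ_of_le (Nat.gcd_le_right _ hd)
  · intro h c _ h1 h2
    exact Nat.eq_one_of_dvd_coprimes h (Nat.dvd_of_mod_eq_zero h1) (Nat.dvd_of_mod_eq_zero h2)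

theorem inS_iff (m : ℕ) : inS m ↔ m ∈ Set.range ratE := by
  unfold inS
  constructor
  · rintro ⟨h0, h⟩
    rw [coprime_iff_aux _ _ h0] at h
    have h' : (Equiv.intEquivNat.symm m.unpair.1).natAbs.Coprime m.unpair.2 := by
      rw [← natAbs_intE]; simpa using h
    refine ⟨⟨Equiv.intEquivNat.symm m.unpair.1, m.unpair.2, h0.ne', h'⟩, ?_⟩
    rw [ratE_def]; simp
  · rintro ⟨q, rfl⟩
    rw [ratE_def]
    simp only [Nat.unpair_pair]
    refine ⟨q.pos, ?_⟩
    rw [coprime_iff_aux _ _ q.pos, natAbs_intE]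
    exact q.reduced

theorem primrec_inS : PrimrecPred inS := by
  have hR : PrimrecRel (fun (c : ℕ) (m : ℕ) =>
      ((m.unpair.1 + 1) / 2) % c = 0 → m.unpair.2 % c = 0 → c = 1) := by
    have h1 : PrimrecPred (fun p : ℕ × ℕ => ((p.2.unpair.1 + 1) / 2) % p.1 = 0) := by
      refine PrimrecRel.comp Primrec.eq ?_ (Primrec.const 0)
      refine Primrec.nat_mod.comp (Primrec.nat_div.comp (Primrec.succ.comp ?_) (Primrec.const 2))
        Primrec.fst
      exact Primrec.fst.comp (Primrec.unpair.comp Primrec.snd)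
    have h2 : PrimrecPred (fun p : ℕ × ℕ => p.2.unpair.2 % p.1 = 0) := by
      refine PrimrecRel.comp Primrec.eq ?_ (Primrec.const 0)
      exact Primrec.nat_mod.comp (Primrec.snd.comp (Primrec.unpair.comp Primrec.snd)) Primrec.fst
    have h3 : PrimrecPred (fun p : ℕ × ℕ => p.1 = 1) :=
      PrimrecRel.comp Primrec.eq Primrec.fst (Primrec.const 1)
    refine PrimrecPred.of_eq ((h1.not.or h2.not).or h3) ?_
    intro p
    tauto
  have hs : Primrec (fun m : ℕ => m.unpair.2) := Primrec.snd.comp Primrec.unpair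
  have := (PrimrecRel.forall_lt hR).comp (Primrec.succ.comp hs) Primrec.id
  exact (PrimrecRel.comp Primrec.nat_lt (Primrec.const 0) hs).and this

theorem ratE_ofNat_strictMono : StrictMono (fun n => ratE (Denumerable.ofNat ℚ n)) := by
  let := @decidableRangeEncode ℚ Rat.instEncodable
  let hi : Infinite (Set.range (@encode ℚ Rat.instEncodable)) :=
    Infinite.of_injective _ (Equiv.ofInjective _ encode_injective).injective
  have key : ∀ n, ratE (Denumerable.ofNat ℚ n) =
      (Nat.Subtype.ofNat (Set.range (@encode ℚ Rat.instEncodable)) n : ℕ) := by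
    intro n
    let := Nat.Subtype.denumerable (Set.range (@encode ℚ Rat.instEncodable))
    have h1 := Denumerable.ofEquiv_ofNat (Set.range (@encode ℚ Rat.instEncodable))
      (@equivRangeEncode ℚ Rat.instEncodable) n
    have h2 : Denumerable.ofNat ℚ n = (@equivRangeEncode ℚ Rat.instEncodable).symm
      (Denumerable.ofNat (Set.range (@encode ℚ Rat.instEncodable)) n) := h1
    have h3 : Denumerable.ofNat (Set.range (@encode ℚ Rat.instEncodable)) n =
      Nat.Subtype.ofNat (Set.range (@encode ℚ Rat.instEncodable)) n := rfl
    rw [h2, h3]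
    exact congrArg Subtype.val ((@equivRangeEncode ℚ Rat.instEncodable).apply_symm_apply _)
  refine strictMono_nat_of_lt_succ fun n => ?_
  rw [key, key]
  exact Nat.Subtype.lt_succ_self _

theorem ratE_computable : Computable ratE := by
  classical
  have hm := ratE_ofNat_strictMono
  have hrange : ∀ m, inS m ↔ ∃ n, ratE (Denumerable.ofNat ℚ n) = m := by
    intro m
    rw [inS_iff]
    constructor
    · rintro ⟨q, rfl⟩
      exact ⟨@encode ℚ Rat.instDenumerable.toEncodable q,
        congrArg ratE (Denumerable.ofNat_encode q)⟩
    · rintro ⟨n, rfl⟩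
      exact ⟨_, rfl⟩
  let P : ℕ → ℕ → Prop := fun n m => inS m ∧ ((List.range m).filter (fun x => inS x)).length = n
  have hcount : ∀ n, ((List.range (ratE (Denumerable.ofNat ℚ n))).filter (fun x => inS x)).length
      = n := by
    intro n
    have : (((List.range (ratE (Denumerable.ofNat ℚ n))).filter (fun x => inS x))).toFinset =
        (Finset.range n).image (fun n => ratE (Denumerable.ofNat ℚ n)) := by
      ext x
      simp only [List.mem_toFinset, List.mem_filter, List.mem_range, decide_eq_true_eq,
        Finset.mem_image, Finset.mem_range]
      constructor
      · rintro ⟨h1, h2⟩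
        obtain ⟨k, rfl⟩ := (hrange x).1 h2
        exact ⟨k, hm.lt_iff_lt.1 h1, rfl⟩
      · rintro ⟨k, h1, rfl⟩
        exact ⟨hm h1, (hrange _).2 ⟨k, rfl⟩⟩
    rw [← List.toFinset_card_of_nodup (List.Nodup.filter _ List.nodup_range), this,
      Finset.card_image_of_injective _ hm.injective, Finset.card_range]
  have hPP : ComputablePred (fun p : ℕ × ℕ => P p.1 p.2) := by
    have h1 : PrimrecPred (fun p : ℕ × ℕ => inS p.2) := primrec_inS.comp Primrec.snd
    have hlen : Primrec (fun p : ℕ × ℕ => ((List.range p.2).filter (fun x => inS x)).length) :=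
      Primrec.list_length.comp ((Primrec.listFilter primrec_inS).comp
        (Primrec.list_range.comp Primrec.snd))
    exact (h1.and (PrimrecRel.comp Primrec.eq hlen Primrec.fst)).computablePred
  have hex : ∀ n, ∃ m, P n m := fun n =>
    ⟨ratE (Denumerable.ofNat ℚ n), (hrange _).2 ⟨n, rfl⟩, hcount n⟩
  have hfind : Computable (fun n => Nat.find (hex n)) := Computable.find hPP hex
  have heq : ∀ n, Nat.find (hex n) = ratE (Denumerable.ofNat ℚ n) := by
    intro n
    have h := Nat.find_spec (hex n)
    obtain ⟨k, hk⟩ := (hrange _).1 h.1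
    have h2 := h.2
    rw [← hk, hcount] at h2
    rw [← hk, h2]
  refine (hfind.comp (Computable.encode (α := ℚ))).of_eq fun q => ?_
  rw [heq]
  exact congrArg ratE (Denumerable.ofNat_encode q)

theorem rat_triple {f : ℕ → ℚ} (hf : Computable f) : ∃ X Y D : ℕ → ℕ, Computable X ∧
    Computable Y ∧ Computable D ∧ ∀ n, 0 < D n ∧ f n = ((X n : ℚ) - Y n) / D n := by
  have hE : Computable (fun n => (ratE (f n)).unpair) :=
    Primrec.unpair.to_comp.comp (ratE_computable.comp hf)
  have hX : Primrec (fun a : ℕ => if a % 2 = 0 then a / 2 else 0) := by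
    refine Primrec.ite (PrimrecRel.comp Primrec.eq
      (Primrec.nat_mod.comp Primrec.id (Primrec.const 2)) (Primrec.const 0)) ?_ (Primrec.const 0)
    exact Primrec.nat_div.comp Primrec.id (Primrec.const 2)
  have hY : Primrec (fun a : ℕ => if a % 2 = 0 then 0 else a / 2 + 1) := by
    refine Primrec.ite (PrimrecRel.comp Primrec.eq
      (Primrec.nat_mod.comp Primrec.id (Primrec.const 2)) (Primrec.const 0)) (Primrec.const 0) ?_
    exact Primrec.succ.comp (Primrec.nat_div.comp Primrec.id (Primrec.const 2))
  refine ⟨_, _, _, hX.to_comp.comp (Computable.fst.comp hE),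
    hY.to_comp.comp (Computable.fst.comp hE), Computable.snd.comp hE, fun n => ?_⟩
  generalize f n = q
  rw [ratE_def]
  simp only [Nat.unpair_pair]
  refine ⟨q.pos, ?_⟩
  rw [eq_div_iff (by exact_mod_cast q.den_nz), Rat.mul_den_eq_num]
  cases q.num with
  | ofNat k => rw [intE_ofNat]; simp
  | negSucc k =>
    have h1 : (2 * k + 1) % 2 = 1 := by omega
    have h2 : (2 * k + 1) / 2 = k := by omega
    rw [intE_negSucc, h1, h2]; simp

end RatCode

section Lists

/-- Value of a list of binary positions. -/
noncomputable def lval (l : List ℕ) : ℝ := (l.map (fun i => (2 : ℝ)⁻¹ ^ (i + 1))).sum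

def lfrac (l : List ℕ) : ℕ × ℕ :=
  l.foldr (fun i p => (p.2 + p.1 * 2 ^ (i + 1), p.2 * 2 ^ (i + 1))) (0, 1)

theorem lfrac_spec (l : List ℕ) : 0 < (lfrac l).2 ∧ lval l = ((lfrac l).1 : ℝ) / (lfrac l).2 := by
  induction l with
  | nil => simp [lfrac, lval]
  | cons i l ih =>
    obtain ⟨h1, h2⟩ := ih
    have e : lfrac (i :: l) = ((lfrac l).2 + (lfrac l).1 * 2 ^ (i + 1), (lfrac l).2 * 2 ^ (i + 1)) :=
      rfl
    have e2 : lval (i :: l) = (2 : ℝ)⁻¹ ^ (i + 1) + lval l := by simp [lval]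
    have h1' : ((lfrac l).2 : ℝ) ≠ 0 := by exact_mod_cast h1.ne'
    rw [e, e2, h2]
    refine ⟨by positivity, ?_⟩
    push_cast
    rw [inv_pow]
    field_simp

theorem primrec_pow (b : ℕ) : Primrec (fun n : ℕ => b ^ n) := by
  have := Primrec.nat_rec₁ (f := fun _ r => r * b) 1
    ((Primrec.nat_mul.comp Primrec.snd (Primrec.const b)).to₂)
  refine this.of_eq fun n => ?_
  induction n with
  | zero => rfl
  | succ n ih => rw [pow_succ, ← ih]

theorem primrec_lfrac : Primrec lfrac := by
  have hpow : Primrec (fun x : List ℕ × ℕ × ℕ × ℕ => 2 ^ (x.2.1 + 1)) :=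
    (primrec_pow 2).comp (Primrec.succ.comp (Primrec.fst.comp Primrec.snd))
  have h1 : Primrec (fun x : List ℕ × ℕ × ℕ × ℕ => x.2.2.1) :=
    Primrec.fst.comp (Primrec.snd.comp Primrec.snd)
  have h2 : Primrec (fun x : List ℕ × ℕ × ℕ × ℕ => x.2.2.2) :=
    Primrec.snd.comp (Primrec.snd.comp Primrec.snd)
  exact Primrec.list_foldr Primrec.id (Primrec.const (0, 1))
    ((Primrec.pair (Primrec.nat_add.comp h2 (Primrec.nat_mul.comp h1 hpow))
      (Primrec.nat_mul.comp h2 hpow)).to₂)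

theorem lval_sub_lt (l m : List ℕ) (X Y D : ℕ) (hD : 0 < D) :
    lval l - lval m < ((((X : ℚ) - Y) / D : ℚ) : ℝ) ↔
    (lfrac l).1 * (lfrac m).2 * D + Y * (lfrac l).2 * (lfrac m).2 <
      X * (lfrac l).2 * (lfrac m).2 + (lfrac m).1 * (lfrac l).2 * D := by
  obtain ⟨h1, e1⟩ := lfrac_spec l
  obtain ⟨h2, e2⟩ := lfrac_spec m
  rw [e1, e2]
  have h1' : (0 : ℝ) < (lfrac l).2 := by exact_mod_cast h1
  have h2' : (0 : ℝ) < (lfrac m).2 := by exact_mod_cast h2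
  have hD' : (0 : ℝ) < D := by exact_mod_cast hD
  push_cast
  rw [div_sub_div _ _ h1'.ne' h2'.ne', div_lt_div_iff₀ (by positivity) hD',
    ← Nat.cast_lt (α := ℝ)]
  push_cast
  constructor <;> intro h <;> nlinarith

theorem re_of_exists {α : Type*} [Primcodable α] {R : α → ℕ → Prop}
    (h : ComputablePred (fun p : α × ℕ => R p.1 p.2)) : REPred (fun a => ∃ n, R a n) := by
  classical
  obtain ⟨_, h⟩ := h
  have h2 : Computable₂ (fun (a : α) (n : ℕ) => decide (R a n)) := by
    refine Computable.of_eq h fun p => ?_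
    congr
  have h3 : Partrec₂ (fun (a : α) (n : ℕ) => (Part.some (decide (R a n)) : Part Bool)) := h2
  refine (Partrec.rfind h3).dom_re.of_eq fun a => ?_
  refine (Nat.rfind_dom (p := fun n => (Part.some (decide (R a n)) : Part Bool))).trans ?_
  simp

theorem re_lists {f : ℕ → ℚ} (hf : Computable f) :
    REPred (fun p : List ℕ × List ℕ => ∃ n, lval p.1 - lval p.2 < (f n : ℝ)) ∧
    REPred (fun p : List ℕ × List ℕ => ∃ n, (f n : ℝ) < lval p.2 - lval p.1) := by
  classical
  obtain ⟨X, Y, D, hX, hY, hD, h⟩ := rat_triple hf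
  have main : ∀ X Y D : ℕ → ℕ, Computable X → Computable Y → Computable D →
      REPred (fun p : List ℕ × List ℕ => ∃ n, 
      (lfrac p.1).1 * (lfrac p.2).2 * D n + Y n * (lfrac p.1).2 * (lfrac p.2).2 <
      X n * (lfrac p.1).2 * (lfrac p.2).2 + (lfrac p.2).1 * (lfrac p.1).2 * D n) := by
    intro X Y D hX hY hD
    refine re_of_exists (R := fun (p : List ℕ × List ℕ) n => 
      (lfrac p.1).1 * (lfrac p.2).2 * D n + Y n * (lfrac p.1).2 * (lfrac p.2).2 <
      X n * (lfrac p.1).2 * (lfrac p.2).2 + (lfrac p.2).1 * (lfrac p.1).2 * D n) ?_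
    have l1 : Computable (fun p : (List ℕ × List ℕ) × ℕ => lfrac p.1.1) :=
      primrec_lfrac.to_comp.comp (Computable.fst.comp Computable.fst)
    have l2 : Computable (fun p : (List ℕ × List ℕ) × ℕ => lfrac p.1.2) :=
      primrec_lfrac.to_comp.comp (Computable.snd.comp Computable.fst)
    have a1 := Computable.fst.comp l1
    have b1 := Computable.snd.comp l1
    have a2 := Computable.fst.comp l2
    have b2 := Computable.snd.comp l2
    have cX := hX.comp (Computable.snd (α := List ℕ × List ℕ) (β := ℕ))
    have cY := hY.comp (Computable.snd (α := List ℕ × List ℕ) (β := ℕ))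
    have cD := hD.comp (Computable.snd (α := List ℕ × List ℕ) (β := ℕ))
    have hmul := Primrec.nat_mul.to_comp
    have hadd := Primrec.nat_add.to_comp
    have lt : Computable₂ (fun a b : ℕ => decide (a < b)) :=
      (Primrec.nat_lt.decide).to_comp
    exact ⟨inferInstance, lt.comp
      (hadd.comp (hmul.comp (hmul.comp a1 b2) cD) (hmul.comp (hmul.comp cY b1) b2))
      (hadd.comp (hmul.comp (hmul.comp cX b1) b2) (hmul.comp (hmul.comp a2 b1) cD))⟩
  constructor
  · refine (main X Y D hX hY hD).of_eq fun p => exists_congr fun n => ?_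
    rw [(h n).2, lval_sub_lt _ _ _ _ _ (h n).1]
  · refine (main Y X D hY hX hD).of_eq fun p => exists_congr fun n => ?_
    rw [(h n).2, ← lval_sub_lt _ _ _ _ _ (h n).1]
    have e : ((((X n : ℚ) - Y n) / D n : ℚ) : ℝ) = - ((((Y n : ℚ) - X n) / D n : ℚ) : ℝ) := by
      push_cast; ring
    rw [e]
    constructor <;> intro h <;> linarith

end Lists

section Construction

open Nat.Partrec (Code)

def MM (k : ℕ) : ℕ := 4 ^ (k + 1)

def rest (b : Bool) (n : ℕ) (S : List (Bool × ℕ)) : List ℕ :=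
  (List.range n).filter (fun i => (b, i) ∈ S)

def query (k : ℕ) (S : List (Bool × ℕ)) : List ℕ × List ℕ :=
  (rest (!k.bodd) (MM (k + 1)) S, (MM (k + 1) - 2) :: rest k.bodd (MM (k + 1)) S)

def fires (k s : ℕ) (S : List (Bool × ℕ)) : Bool :=
  (Code.evaln s (Denumerable.ofNat Code k.div2) (encode (query k S))).isSome

def newElt (k : ℕ) (S : List (Bool × ℕ)) : Bool × ℕ :=
  (k.bodd, MM k + (rest (!k.bodd) (MM k) S).length)

def step (s : ℕ) (S : List (Bool × ℕ)) : List (Bool × ℕ) :=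
  bif fires s.unpair.1 s S then newElt s.unpair.1 S :: S else S

def St (n : ℕ) : List (Bool × ℕ) := Nat.rec [] step n

theorem St_succ (n : ℕ) : St (n + 1) = step n (St n) := rfl

def XX (b : Bool) : Set ℕ := {i | ∃ s, (b, i) ∈ St s}

/-! Computability of the construction -/

theorem primrec_rest : Primrec (fun x : Bool × ℕ × List (Bool × ℕ) => rest x.1 x.2.1 x.2.2) := by
  have hmem : PrimrecRel (fun (L : List (Bool × ℕ)) (x : Bool × ℕ) => x ∈ L) := by
    have := PrimrecRel.exists_mem_list (R := fun a b : Bool × ℕ => a = b) Primrec.eq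
    refine PrimrecPred.of_eq this fun p => ?_
    simp
  have hR : PrimrecRel (fun (i : ℕ) (y : Bool × List (Bool × ℕ)) => (y.1, i) ∈ y.2) :=
    PrimrecRel.comp hmem (Primrec.snd.comp Primrec.snd)
      (Primrec.pair (Primrec.fst.comp Primrec.snd) Primrec.fst)
  exact (PrimrecRel.listFilter hR).comp
    (Primrec.list_range.comp (Primrec.fst.comp Primrec.snd))
    (Primrec.pair Primrec.fst (Primrec.snd.comp Primrec.snd))

theorem primrec_MM : Primrec MM := (primrec_pow 4).comp Primrec.succ

theorem primrec_query : Primrec₂ query := by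
  have hb : Primrec (fun x : ℕ × List (Bool × ℕ) => x.1.bodd) :=
    Primrec.nat_bodd.comp Primrec.fst
  have hM : Primrec (fun x : ℕ × List (Bool × ℕ) => MM (x.1 + 1)) :=
    primrec_MM.comp (Primrec.succ.comp Primrec.fst)
  refine Primrec.pair (primrec_rest.comp (Primrec.pair (Primrec.not.comp hb)
    (Primrec.pair hM Primrec.snd))) ?_
  exact Primrec.list_cons.comp (Primrec.nat_sub.comp hM (Primrec.const 2))
    (primrec_rest.comp (Primrec.pair hb (Primrec.pair hM Primrec.snd)))

theorem primrec_newElt : Primrec₂ newElt := by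
  have hb : Primrec (fun x : ℕ × List (Bool × ℕ) => x.1.bodd) :=
    Primrec.nat_bodd.comp Primrec.fst
  have hM : Primrec (fun x : ℕ × List (Bool × ℕ) => MM x.1) :=
    primrec_MM.comp Primrec.fst
  exact Primrec.pair hb (Primrec.nat_add.comp hM (Primrec.list_length.comp
    (primrec_rest.comp (Primrec.pair (Primrec.not.comp hb) (Primrec.pair hM Primrec.snd)))))

theorem primrec_step : Primrec₂ step := by
  have hk : Primrec (fun x : ℕ × List (Bool × ℕ) => x.1.unpair.1) :=
    Primrec.fst.comp (Primrec.unpair.comp Primrec.fst)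
  have hf : Primrec (fun x : ℕ × List (Bool × ℕ) => fires x.1.unpair.1 x.1 x.2) := by
    have h1 : Primrec (fun x : ℕ × List (Bool × ℕ) =>
        Denumerable.ofNat Code x.1.unpair.1.div2) :=
      (Primrec.ofNat Code).comp (Primrec.nat_div2.comp hk)
    have h2 : Primrec (fun x : ℕ × List (Bool × ℕ) => query x.1.unpair.1 x.2) :=
      primrec_query.comp hk Primrec.snd
    have h3 : Primrec (fun x : ℕ × List (Bool × ℕ) => encode (query x.1.unpair.1 x.2)) :=
      Primrec.encode.comp h2
    have h4 : Primrec (fun x : ℕ × List (Bool × ℕ) =>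
        ((x.1, Denumerable.ofNat Code x.1.unpair.1.div2), encode (query x.1.unpair.1 x.2))) :=
      Primrec.pair (Primrec.pair Primrec.fst h1) h3
    have h5 := Nat.Partrec.Code.primrec_evaln.comp h4
    exact Primrec.option_isSome.comp h5
  exact Primrec.cond hf (Primrec.list_cons.comp (primrec_newElt.comp hk Primrec.snd) Primrec.snd) Primrec.snd

theorem primrec_St : Primrec St := Primrec.nat_rec₁ [] primrec_step

theorem ce_XX (b : Bool) : CESet (XX b) := by
  classical
  have hmem : PrimrecRel (fun (L : List (Bool × ℕ)) (x : Bool × ℕ) => x ∈ L) := by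
    have := PrimrecRel.exists_mem_list (R := fun a b : Bool × ℕ => a = b) Primrec.eq
    refine PrimrecPred.of_eq this fun p => ?_
    simp
  have h : PrimrecPred (fun p : ℕ × ℕ => (b, p.1) ∈ St p.2) :=
    PrimrecRel.comp hmem (primrec_St.comp Primrec.snd)
      (Primrec.pair (Primrec.const b) Primrec.fst)
  have h2 : REPred (fun i : ℕ => ∃ s, (b, i) ∈ St s) :=
    re_of_exists (R := fun i s => (b, i) ∈ St s) h.computablePred
  refine ⟨_, Partrec.map h2 ((Computable.const 0).to₂), fun n => ?_⟩
  simp [XX, Part.assert]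

/-! Combinatorics of the construction -/

theorem St_mono {s t : ℕ} (h : s ≤ t) {x : Bool × ℕ} (hx : x ∈ St s) : x ∈ St t := by
  induction h with
  | refl => exact hx
  | step h ih =>
    rw [St_succ, step]
    cases fires _ _ _ <;> simp [ih]

theorem rest_length_le (b : Bool) (n : ℕ) (S) : (rest b n S).length ≤ n := by
  have := List.length_filter_le (fun i => decide ((b, i) ∈ S)) (List.range n)
  rw [List.length_range] at this
  exact this

theorem fired_of_mem {x : Bool × ℕ} {s : ℕ} (hx : x ∈ St s) :
    ∃ k t, x ∉ St t ∧ fires k t (St t) = true ∧ x = newElt k (St t) := by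
  induction s with
  | zero => simp [St] at hx
  | succ s ih =>
    by_cases h : x ∈ St s
    · exact ih h
    · rw [St_succ, step] at hx
      cases hf : fires s.unpair.1 s (St s) with
      | false => rw [hf] at hx; exact absurd hx h
      | true =>
        rw [hf] at hx
        simp only [cond_true, List.mem_cons, h, or_false] at hx
        exact ⟨_, s, h, hf, hx⟩

theorem MM_pos (k : ℕ) : 4 ≤ MM k := by
  unfold MM
  rw [pow_succ]
  have : 1 ≤ 4 ^ k := Nat.one_le_pow _ _ (by norm_num)
  omega

theorem MM_succ (k : ℕ) : MM (k + 1) = 4 * MM k := by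
  unfold MM; ring

theorem MM_mono {j k : ℕ} (h : j ≤ k) : MM j ≤ MM k :=
  Nat.pow_le_pow_right (by norm_num) (by omega)

theorem newElt_bounds (k : ℕ) (S) :
    MM k ≤ (newElt k S).2 ∧ (newElt k S).2 + 3 ≤ MM (k + 1) := by
  have h1 := rest_length_le (!k.bodd) (MM k) S
  have h2 := MM_pos k
  rw [MM_succ]
  simp only [newElt]
  omega

theorem k_unique {j k x : ℕ} (h1 : MM j ≤ x) (h2 : x < MM (j + 1)) (h3 : MM k ≤ x)
    (h4 : x < MM (k + 1)) : j = k := by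
  rcases lt_trichotomy j k with h | h | h
  · have := MM_mono (show j + 1 ≤ k from h); omega
  · exact h
  · have := MM_mono (show k + 1 ≤ j from h); omega

theorem settle (b : Bool) (n : ℕ) : ∃ s₀, ∀ s, s₀ ≤ s → ∀ i < n, (b, i) ∈ St s ↔ i ∈ XX b := by
  induction n with
  | zero => exact ⟨0, by simp⟩
  | succ n ih =>
    obtain ⟨s₀, h⟩ := ih
    by_cases hn : n ∈ XX b
    · obtain ⟨s₁, h1⟩ := id hn
      refine ⟨max s₀ s₁, fun s hs i hi => ?_⟩
      rcases Nat.lt_succ_iff_lt_or_eq.1 hi with hi | rfl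
      · exact h s (le_trans (le_max_left _ _) hs) i hi
      · exact ⟨fun _ => hn, fun _ => St_mono (le_trans (le_max_right _ _) hs) h1⟩
    · refine ⟨s₀, fun s hs i hi => ?_⟩
      rcases Nat.lt_succ_iff_lt_or_eq.1 hi with hi | rfl
      · exact h s hs i hi
      · exact ⟨fun h => ⟨s, h⟩, fun h => absurd h hn⟩

/-! Values -/

open Classical in
noncomputable def trunc (A : Set ℕ) (n : ℕ) : ℝ :=
  ∑ i ∈ (Finset.range n).filter (· ∈ A), (2 : ℝ)⁻¹ ^ (i + 1)

theorem trunc_bounds (A : Set ℕ) (n : ℕ) :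
    trunc A n ≤ realOfSet A ∧ realOfSet A ≤ trunc A n + (2 : ℝ)⁻¹ ^ n := by
  classical
  have hg : HasSum (fun i : ℕ => (2 : ℝ)⁻¹ ^ (i + n + 1)) ((2 : ℝ)⁻¹ ^ n) := by
    have := (hasSum_geometric_of_lt_one (r := (2 : ℝ)⁻¹) (by norm_num) (by norm_num)).mul_left
      ((2 : ℝ)⁻¹ ^ (n + 1))
    have e1 : (fun i : ℕ => (2 : ℝ)⁻¹ ^ (n + 1) * (2 : ℝ)⁻¹ ^ i) =
        fun i : ℕ => (2 : ℝ)⁻¹ ^ (i + n + 1) := by funext i; ring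
    have e2 : (2 : ℝ)⁻¹ ^ (n + 1) * (1 - (2 : ℝ)⁻¹)⁻¹ = (2 : ℝ)⁻¹ ^ n := by
      rw [pow_succ]; norm_num; ring
    rw [e1, e2] at this
    exact this
  have hs0 : Summable (fun i : ℕ => (2 : ℝ)⁻¹ ^ (i + 1)) :=
    (summable_nat_add_iff 1).2 (summable_geometric_of_lt_one (by norm_num) (by norm_num))
  have hs : Summable (Set.indicator A (fun n => (2 : ℝ)⁻¹ ^ (n + 1))) := hs0.indicator A
  have hsplit := hs.sum_add_tsum_nat_add n
  have ht : trunc A n = ∑ i ∈ Finset.range n, Set.indicator A (fun n => (2 : ℝ)⁻¹ ^ (n + 1)) i := by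
    rw [trunc, Finset.sum_filter]
    exact Finset.sum_congr rfl fun i _ => by simp [Set.indicator_apply]
  have hnn : ∀ i, 0 ≤ Set.indicator A (fun n => (2 : ℝ)⁻¹ ^ (n + 1)) i := fun i =>
    Set.indicator_nonneg (fun _ _ => by positivity) i
  have h0 : 0 ≤ ∑' i, Set.indicator A (fun n => (2 : ℝ)⁻¹ ^ (n + 1)) (i + n) :=
    tsum_nonneg fun i => hnn _
  have h1 : ∑' i, Set.indicator A (fun n => (2 : ℝ)⁻¹ ^ (n + 1)) (i + n) ≤ (2 : ℝ)⁻¹ ^ n := by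
    rw [← hg.tsum_eq]
    refine ((summable_nat_add_iff n).2 hs).tsum_le_tsum (fun i => ?_) hg.summable
    exact Set.indicator_le_self' (fun _ _ => by positivity) (i + n)
  unfold realOfSet
  rw [ht, ← hsplit]
  constructor <;> linarith

theorem lval_rest (b : Bool) (n : ℕ) (S : List (Bool × ℕ)) :
    lval (rest b n S) = trunc {i | (b, i) ∈ S} n := by
  classical
  unfold lval rest trunc
  rw [← List.sum_toFinset _ (List.Nodup.filter _ List.nodup_range)]
  refine Finset.sum_congr ?_ fun _ _ => rfl
  ext i
  simp

theorem trunc_congr {A B : Set ℕ} {n : ℕ} (h : ∀ i < n, i ∈ A ↔ i ∈ B) :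
    trunc A n = trunc B n := by
  classical
  unfold trunc
  refine Finset.sum_congr ?_ fun _ _ => rfl
  ext i
  simp only [Finset.mem_filter, Finset.mem_range]
  exact and_congr_right fun hi => h i hi

theorem trunc_add_le {A B : Set ℕ} {n p : ℕ} (h : ∀ i < n, i ∈ A → i ∈ B) (hp : p < n)
    (hpA : p ∉ A) (hpB : p ∈ B) : trunc A n + (2 : ℝ)⁻¹ ^ (p + 1) ≤ trunc B n := by
  classical
  unfold trunc
  rw [add_comm, ← Finset.sum_insert (f := fun i => (2 : ℝ)⁻¹ ^ (i + 1)) (a := p) (by simp [hpA])]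
  refine Finset.sum_le_sum_of_subset_of_nonneg ?_ fun _ _ _ => by positivity
  intro i hi
  simp only [Finset.mem_insert, Finset.mem_filter, Finset.mem_range] at hi ⊢
  rcases hi with rfl | ⟨h1, h2⟩
  · exact ⟨hp, hpB⟩
  · exact ⟨h1, h i h1 h2⟩

theorem rest_eq_of_length {b : Bool} {n t s : ℕ}
    (hts : (rest b n (St t)).length = (rest b n (St s)).length)
    (hs : ∀ i < n, (b, i) ∈ St s ↔ i ∈ XX b) :
    ∀ i < n, (b, i) ∈ St t ↔ i ∈ XX b := by
  classical
  have hnd : ∀ s, (rest b n (St s)).Nodup := fun s => List.Nodup.filter _ List.nodup_range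
  have hmem : ∀ s i, i ∈ (rest b n (St s)).toFinset ↔ i < n ∧ (b, i) ∈ St s := by
    intro s i; simp [rest]
  have hsub : (rest b n (St t)).toFinset ⊆ (rest b n (St s)).toFinset := by
    intro i hi
    rw [hmem] at hi ⊢
    exact ⟨hi.1, (hs i hi.1).2 ⟨t, hi.2⟩⟩
  have heq := Finset.eq_of_subset_of_card_le hsub (by
    rw [List.toFinset_card_of_nodup (hnd _), List.toFinset_card_of_nodup (hnd _), hts])
  intro i hi
  rw [← hs i hi]
  have := hmem t i
  rw [heq, hmem] at this
  tauto

theorem lval_cons (i : ℕ) (l : List ℕ) : lval (i :: l) = (2 : ℝ)⁻¹ ^ (i + 1) + lval l := by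
  simp [lval]

theorem main_diag (b : Bool) : ¬ REPred (fun p : List ℕ × List ℕ =>
    lval p.1 - lval p.2 < realOfSet (XX (!b)) - realOfSet (XX b)) := by
  intro hre
  -- get a code
  obtain ⟨c, hc⟩ := Nat.Partrec.Code.exists_code.1 (show Nat.Partrec _ from hre)
  have hdom : ∀ p : List ℕ × List ℕ, (∃ s, (Code.evaln s c (encode p)).isSome = true) ↔
      lval p.1 - lval p.2 < realOfSet (XX (!b)) - realOfSet (XX b) := by
    intro p
    have h1 : (c.eval (encode p)).Dom ↔
        lval p.1 - lval p.2 < realOfSet (XX (!b)) - realOfSet (XX b) := by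
      rw [hc]; simp only [encodek]; simp [Part.assert]
    rw [← h1, Part.dom_iff_mem]
    constructor
    · rintro ⟨s, hs⟩
      obtain ⟨y, hy⟩ := Option.isSome_iff_exists.1 hs
      exact ⟨y, Code.evaln_complete.2 ⟨s, hy⟩⟩
    · rintro ⟨y, hy⟩
      obtain ⟨s, hs⟩ := Code.evaln_complete.1 hy
      exact ⟨s, Option.isSome_iff_exists.2 ⟨y, hs⟩⟩
  obtain ⟨k, hkb, hkc⟩ : ∃ k : ℕ, k.bodd = b ∧ Denumerable.ofNat Code k.div2 = c :=
    ⟨Nat.bit b (encode c), by simp, by simp⟩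
  set N := MM (k + 1) with hN
  have hN4 : 16 ≤ N := by rw [hN, MM_succ]; have := MM_pos k; omega
  have hlt : MM k ≤ N := MM_mono (Nat.le_succ k)
  -- settled stage
  obtain ⟨s₁, hs₁⟩ := settle b N
  obtain ⟨s₂, hs₂⟩ := settle (!b) N
  -- arithmetic of powers
  have hpow : (2 : ℝ)⁻¹ ^ (N - 2 + 1) = 2 * (2 : ℝ)⁻¹ ^ N := by
    obtain ⟨m, hm⟩ : ∃ m, N = m + 2 := ⟨N - 2, by omega⟩
    rw [hm]; simp only [Nat.add_sub_cancel]; ring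
  have hNpos : (0 : ℝ) < (2 : ℝ)⁻¹ ^ N := by positivity
  obtain ⟨hA1, hA2⟩ := trunc_bounds (XX (!b)) N
  obtain ⟨hB1, hB2⟩ := trunc_bounds (XX b) N
  have hq : ∀ s, lval (query k (St s)).1 - lval (query k (St s)).2 =
      trunc {i | (!b, i) ∈ St s} N - (2 * (2 : ℝ)⁻¹ ^ N + trunc {i | (b, i) ∈ St s} N) := by
    intro s
    simp only [query, hkb]
    rw [lval_cons, lval_rest, lval_rest, ← hN, hpow]
  have hqe : ∀ s, max s₁ s₂ ≤ s → query k (St s) = query k (St (max s₁ s₂)) := by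
    intro s hs
    simp only [query, hkb, rest]
    refine Prod.ext ?_ ?_
    · refine List.filter_congr fun i hi => ?_
      have hi := List.mem_range.1 hi
      rw [decide_eq_decide, hs₂ _ (le_trans (le_max_right _ _) hs) i hi,
        hs₂ _ (le_max_right _ _) i hi]
    · refine congrArg (List.cons _) (List.filter_congr fun i hi => ?_)
      have hi := List.mem_range.1 hi
      rw [decide_eq_decide, hs₁ _ (le_trans (le_max_left _ _) hs) i hi,
        hs₁ _ (le_max_left _ _) i hi]
  -- the final query is answered positively
  obtain ⟨r, hr⟩ := (hdom (query k (St (max s₁ s₂)))).2 (by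
    rw [hq, trunc_congr (A := {i | (!b, i) ∈ St (max s₁ s₂)}) (B := XX (!b)) (hs₂ _ (le_max_right _ _)),
      trunc_congr (A := {i | (b, i) ∈ St (max s₁ s₂)}) (B := XX b) (hs₁ _ (le_max_left _ _))]
    linarith)
  let s := Nat.pair k (max r (max s₁ s₂))
  have hsr : max r (max s₁ s₂) ≤ s := Nat.right_le_pair _ _
  have hsm : max s₁ s₂ ≤ s := le_trans (le_max_right _ _) hsr
  have hfire : fires k s (St s) = true := by
    unfold fires
    rw [hkc, hqe s hsm]
    obtain ⟨y, hy⟩ := Option.isSome_iff_exists.1 hr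
    exact Option.isSome_iff_exists.2
      ⟨y, Code.evaln_mono (le_trans (le_max_left _ _) hsr) hy⟩
  have hmem : newElt k (St s) ∈ St (s + 1) := by
    rw [St_succ, step]
    have : s.unpair.1 = k := by simp [s]
    rw [this, hfire]
    simp
  -- the first time this element was enumerated
  obtain ⟨k', t, hnot, hft, heq⟩ := fired_of_mem hmem
  obtain ⟨hb1, hb2⟩ := newElt_bounds k (St s)
  have hkk : k' = k := by
    obtain ⟨hb3, hb4⟩ := newElt_bounds k' (St t)
    rw [← heq] at hb3 hb4
    exact k_unique hb3 (by omega) hb1 (by omega)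
  subst hkk
  have hlen : (rest (!b) (MM k') (St t)).length = (rest (!b) (MM k') (St s)).length := by
    have := congrArg Prod.snd heq
    simp only [newElt, hkb] at this
    omega
  have hlow := rest_eq_of_length hlen fun i hi =>
    hs₂ s (le_trans (le_max_right _ _) hsm) i (lt_of_lt_of_le hi hlt)
  have hall : ∀ i < N, (!b, i) ∈ St t ↔ i ∈ XX (!b) := by
    intro i hi
    by_cases h : i < MM k'
    · exact hlow i h
    · refine ⟨fun h => ⟨t, h⟩, ?_⟩
      rintro ⟨u, hu⟩
      exfalso
      obtain ⟨j, v, -, -, hj⟩ := fired_of_mem hu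
      obtain ⟨hb3, hb4⟩ := newElt_bounds j (St v)
      rw [← hj] at hb3 hb4
      have hjk : j = k' := k_unique hb3 (by omega) (not_lt.1 h) hi
      have := congrArg Prod.fst hj
      simp only [newElt, hjk, hkb] at this
      cases b <;> simp at this
  have htq : lval (query k' (St t)).1 - lval (query k' (St t)).2 <
      realOfSet (XX (!b)) - realOfSet (XX b) := by
    refine (hdom _).1 ⟨t, ?_⟩
    unfold fires at hft
    rwa [hkc] at hft
  rw [hq, trunc_congr (A := {i | (!b, i) ∈ St t}) (B := XX (!b)) hall] at htq
  have hfst : ∀ S, newElt k' S = (b, (newElt k' S).2) := fun S => by simp [newElt, hkb]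
  have hinc := trunc_add_le (A := {i | (b, i) ∈ St t}) (B := XX b) (n := N)
    (p := (newElt k' (St s)).2) (fun i _ h => ⟨t, h⟩) (by omega)
    (by intro h; exact hnot (by rw [hfst]; exact h))
    ⟨s + 1, by rw [← hfst]; exact hmem⟩
  have hp4 : 4 * (2 : ℝ)⁻¹ ^ N ≤ (2 : ℝ)⁻¹ ^ ((newElt k' (St s)).2 + 1) := by
    have h1 : (2 : ℝ)⁻¹ ^ (N - 2) ≤ (2 : ℝ)⁻¹ ^ ((newElt k' (St s)).2 + 1) :=
      pow_le_pow_of_le_one (by norm_num) (by norm_num) (by omega)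
    have h2 : (2 : ℝ)⁻¹ ^ (N - 2) = 4 * (2 : ℝ)⁻¹ ^ N := by
      obtain ⟨m, hm⟩ : ∃ m, N = m + 2 := ⟨N - 2, by omega⟩
      rw [hm]; simp only [Nat.add_sub_cancel]; ring
    linarith
  linarith

end Construction

theorem lt_lim_iff {f : ℕ → ℚ} {γ : ℝ} (hm : StrictMono f)
    (ht : Tendsto (fun n => (f n : ℝ)) atTop (nhds γ)) (x : ℝ) :
    (∃ n, x < (f n : ℝ)) ↔ x < γ := by
  constructor
  · rintro ⟨n, hn⟩
    have hmono : Monotone (fun n => (f n : ℝ)) := fun a b h =>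
      Rat.cast_le.2 (hm.monotone h)
    exact hn.trans_le (hmono.ge_of_tendsto ht n)
  · intro h
    exact (ht.eventually (lt_mem_nhds h)).exists

theorem gt_lim_iff {f : ℕ → ℚ} {γ : ℝ} (hm : StrictAnti f)
    (ht : Tendsto (fun n => (f n : ℝ)) atTop (nhds γ)) (x : ℝ) :
    (∃ n, (f n : ℝ) < x) ↔ γ < x := by
  constructor
  · rintro ⟨n, hn⟩
    have hmono : Antitone (fun n => (f n : ℝ)) := fun a b h =>
      Rat.cast_le.2 (hm.antitone h)
    exact (hmono.le_of_tendsto ht n).trans_lt hn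
  · intro h
    exact (ht.eventually (gt_mem_nhds h)).exists

theorem statement3 :
    ∃ α β : ℝ, StronglyLeftCE α ∧ StronglyLeftCE β ∧
      ¬ LeftCE (α - β) ∧ ¬ RightCE (α - β) := by
  refine ⟨realOfSet (XX true), realOfSet (XX false), ⟨_, ce_XX _, rfl⟩, ⟨_, ce_XX _, rfl⟩, ?_, ?_⟩
  · rintro ⟨f, hf, hm, ht⟩
    refine main_diag false ((re_lists hf).1.of_eq fun p => ?_)
    exact lt_lim_iff hm ht _
  · rintro ⟨f, hf, hm, ht⟩
    refine main_diag true ((re_lists hf).2.of_eq fun p => ?_)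
    rw [gt_lim_iff hm ht]
    constructor <;> intro h <;> simp only [Bool.not_true] at * <;> linarith
end

section
/- For left-c.e. reals α and β, the following are equivalent: (a) there exists a positive rational q such that qα − β is left-c.e.; (b) there exist a positive rational q and increasing computable rational approximations (α_s) → α, (β_s) → β such that β − β_s < q·(α − α_s) for all s; (c) there exist a positive rational q and increasing computable rational approximations (α_s) → α, (β_s) → β such that β_{s+1} − β_s < q·(α_{s+1} − α_s) for all s. -/
open Filter

namespace RatComp
open Encodable

abbrev E (q : ℚ) : ℕ := @encode ℚ Rat.instEncodable q

instance decE : DecidablePred (· ∈ Set.range E) := @decidableRangeEncode ℚ _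

lemma E_eq (q : ℚ) : E q = Nat.pair (encode q.num) q.den := rfl

lemma D_eq (q : ℚ) : (@encode ℚ Primcodable.toEncodable q) =
    (List.range (E q)).countP (· ∈ Set.range E) := rfl

abbrev dEnc (q : ℚ) : ℕ := @encode ℚ Primcodable.toEncodable q

lemma dEnc_inj : Function.Injective dEnc := @encode_injective ℚ Primcodable.toEncodable

lemma E_inj : Function.Injective E := @encode_injective ℚ Rat.instEncodable

lemma natAbs_eq (z : ℤ) : z.natAbs = (encode z + 1) / 2 := by
  cases z with
  | ofNat n => 
    have : encode (Int.ofNat n) = 2 * n := rfl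
    rw [this]; simp; omega
  | negSucc n => 
    have : encode (Int.negSucc n) = 2 * n + 1 := rfl
    rw [this]; simp; omega

lemma int_eq (z : ℤ) : z = ((((encode z + 1) / 2) * (1 - encode z % 2) : ℕ) : ℤ) -
    ((((encode z + 1) / 2) * (encode z % 2) : ℕ) : ℤ) := by
  cases z with
  | ofNat n => 
    have : encode (Int.ofNat n) = 2 * n := rfl
    rw [this]
    have h1 : (2 * n + 1) / 2 = n := by omega
    have h2 : 2 * n % 2 = 0 := by omega
    simp [h1, h2]
  | negSucc n => 
    have : encode (Int.negSucc n) = 2 * n + 1 := rfl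
    rw [this]
    have h1 : (2 * n + 1 + 1) / 2 = n + 1 := by omega
    have h2 : (2 * n + 1) % 2 = 1 := by omega
    rw [h1, h2]
    simp [Int.negSucc_eq]

lemma range_iff (m : ℕ) : m ∈ Set.range E ↔
    0 < m.unpair.2 ∧ ∀ k < m.unpair.2 + 1,
      ¬ (¬ k = 1 ∧ ((m.unpair.1 + 1) / 2) % k = 0 ∧ m.unpair.2 % k = 0) := by
  constructor
  · rintro ⟨q, rfl⟩
    rw [E_eq, Nat.unpair_pair]
    simp only
    refine ⟨q.pos, ?_⟩
    rintro k _ ⟨h1, h2, h3⟩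
    rw [← natAbs_eq] at h2
    exact h1 (Nat.eq_one_of_dvd_coprimes q.reduced (Nat.dvd_of_mod_eq_zero h2)
      (Nat.dvd_of_mod_eq_zero h3))
  · rintro ⟨h0, h⟩
    set z : ℤ := Denumerable.ofNat ℤ m.unpair.1 with hz
    have hz' : encode z = m.unpair.1 := by rw [hz]; exact Denumerable.encode_ofNat _
    have hc : z.natAbs.Coprime m.unpair.2 := by
      by_contra hne
      refine h (Nat.gcd z.natAbs m.unpair.2)
        (Nat.lt_succ_of_le (Nat.le_of_dvd h0 (Nat.gcd_dvd_right _ _))) ⟨hne, ?_, ?_⟩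
      · rw [← hz', ← natAbs_eq]; exact Nat.mod_eq_zero_of_dvd (Nat.gcd_dvd_left _ _)
      · exact Nat.mod_eq_zero_of_dvd (Nat.gcd_dvd_right _ _)
    refine ⟨⟨z, m.unpair.2, h0.ne', hc⟩, ?_⟩
    rw [E_eq]
    simp only [hz', Nat.pair_unpair]

lemma u1 : Primrec fun m : ℕ => m.unpair.1 := Primrec.fst.comp Primrec.unpair
lemma u2 : Primrec fun m : ℕ => m.unpair.2 := Primrec.snd.comp Primrec.unpair
lemma uh : Primrec fun m : ℕ => (m.unpair.1 + 1) / 2 :=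
  Primrec.nat_div.comp (Primrec.succ.comp u1) (Primrec.const 2)

lemma range_prim : PrimrecPred fun m : ℕ => m ∈ Set.range E := by
  have hR : PrimrecRel fun (k m : ℕ) =>
      ¬ (¬ k = 1 ∧ ((m.unpair.1 + 1) / 2) % k = 0 ∧ m.unpair.2 % k = 0) := by
    have a1 : PrimrecPred fun p : ℕ × ℕ => ¬ p.1 = 1 :=
      (Primrec.eq.comp Primrec.fst (Primrec.const 1)).not
    have a2 : PrimrecPred fun p : ℕ × ℕ => ((p.2.unpair.1 + 1) / 2) % p.1 = 0 :=
      Primrec.eq.comp (Primrec.nat_mod.comp (uh.comp Primrec.snd) Primrec.fst) (Primrec.const 0)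
    have a3 : PrimrecPred fun p : ℕ × ℕ => p.2.unpair.2 % p.1 = 0 :=
      Primrec.eq.comp (Primrec.nat_mod.comp (u2.comp Primrec.snd) Primrec.fst) (Primrec.const 0)
    exact (a1.and (a2.and a3)).not
  have h1 : PrimrecPred fun m : ℕ => 0 < m.unpair.2 := Primrec.nat_lt.comp (Primrec.const 0) u2
  have h2 := hR.forall_lt.comp (Primrec.succ.comp u2) Primrec.id
  exact (h1.and h2).of_eq fun m => (range_iff m).symm

def cnt (m : ℕ) : ℕ := (List.range m).countP (· ∈ Set.range E)

lemma cnt_prim : Primrec cnt := by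
  have h := Primrec.list_length.comp ((Primrec.listFilter range_prim).comp Primrec.list_range)
  refine h.of_eq fun m => ?_
  rw [cnt, List.countP_eq_length_filter]

lemma computable_of_search {γ : Type*} [Primcodable γ] (f : γ → ℕ) (p : γ → ℕ → Bool)
    (hp : Computable₂ p) (h : ∀ x n, p x n = true ↔ f x = n) : Computable f := by
  have h1 : Partrec fun x => Nat.rfind fun n => Part.some (p x n) := Partrec.rfind hp.partrec₂
  refine h1.of_eq_tot fun x => Nat.mem_rfind.2 ?_
  refine ⟨?_, fun {m} hm => ?_⟩
  · rw [Part.mem_some_iff]; exact ((h x _).2 rfl).symm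
  · rw [Part.mem_some_iff]
    by_contra hne
    have : p x m = true := by cases hh : p x m <;> simp_all
    exact hm.ne' ((h x m).1 this)

lemma computable_E : Computable E := by
  refine computable_of_search E
    (fun q m => decide (m ∈ Set.range E ∧ cnt m = dEnc q)) ?_ ?_
  · have a1 : PrimrecPred fun p : ℚ × ℕ => p.2 ∈ Set.range E := range_prim.comp Primrec.snd
    have a2 : PrimrecPred fun p : ℚ × ℕ => cnt p.2 = dEnc p.1 :=
      Primrec.eq.comp (cnt_prim.comp Primrec.snd) (Primrec.encode.comp Primrec.fst)
    exact ((a1.and a2).decide).to_comp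
  · intro q m
    rw [decide_eq_true_iff]
    constructor
    · rintro ⟨⟨r, rfl⟩, h⟩
      have h' : dEnc r = dEnc q := h
      rw [dEnc_inj h']
    · rintro rfl
      exact ⟨⟨q, rfl⟩, (D_eq q).symm⟩

def rp (q : ℚ) : ℕ := ((E q).unpair.1 + 1) / 2 * (1 - (E q).unpair.1 % 2)
def rn (q : ℚ) : ℕ := ((E q).unpair.1 + 1) / 2 * ((E q).unpair.1 % 2)
def rd (q : ℚ) : ℕ := (E q).unpair.2

lemma rp_comp : Computable rp := by
  have : Primrec fun m : ℕ => (m.unpair.1 + 1) / 2 * (1 - m.unpair.1 % 2) :=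
    Primrec.nat_mul.comp uh (Primrec.nat_sub.comp (Primrec.const 1)
      (Primrec.nat_mod.comp u1 (Primrec.const 2)))
  exact this.to_comp.comp computable_E

lemma rn_comp : Computable rn := by
  have : Primrec fun m : ℕ => (m.unpair.1 + 1) / 2 * (m.unpair.1 % 2) :=
    Primrec.nat_mul.comp uh (Primrec.nat_mod.comp u1 (Primrec.const 2))
  exact this.to_comp.comp computable_E

lemma rd_comp : Computable rd := u2.to_comp.comp computable_E

lemma rd_eq (q : ℚ) : rd q = q.den := by rw [rd, E_eq, Nat.unpair_pair]

lemma rd_pos (q : ℚ) : (0 : ℚ) < rd q := by rw [rd_eq]; exact_mod_cast q.pos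

lemma rat_eq (q : ℚ) : q = ((rp q : ℚ) - rn q) / rd q := by
  have h : (q.num : ℤ) = (rp q : ℤ) - rn q := by
    rw [rp, rn, E_eq, Nat.unpair_pair]
    exact int_eq q.num
  have h' : (q.num : ℚ) = (rp q : ℚ) - rn q := by exact_mod_cast h
  rw [← h', rd_eq, Rat.num_div_den]

section
variable {γ : Type*} [Primcodable γ]

lemma nadd {f g : γ → ℕ} (hf : Computable f) (hg : Computable g) :
    Computable fun x => f x + g x := Primrec.nat_add.to_comp.comp hf hg
lemma nmul {f g : γ → ℕ} (hf : Computable f) (hg : Computable g) :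
    Computable fun x => f x * g x := Primrec.nat_mul.to_comp.comp hf hg
lemma neq {f g : γ → ℕ} (hf : Computable f) (hg : Computable g) :
    Computable fun x => decide (f x = g x) :=
  (Primrec.eq (α := ℕ)).decide.to_comp.comp hf hg
lemma nle {f g : γ → ℕ} (hf : Computable f) (hg : Computable g) :
    Computable fun x => decide (f x ≤ g x) := Primrec.nat_le.decide.to_comp.comp hf hg

/-- A function with decidable graph, given by a pair of natural numbers functions, is computable. -/
lemma graph (f : γ → ℚ) (u v : γ × ℚ → ℕ) (hu : Computable u) (hv : Computable v)
    (h : ∀ x r, f x = r ↔ u (x, r) = v (x, r)) : Computable f := by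
  have : Computable fun x => dEnc (f x) := by
    refine computable_of_search _ (fun x n => decide (u (x, Denumerable.ofNat ℚ n) =
      v (x, Denumerable.ofNat ℚ n))) ?_ ?_
    · have hp : Computable fun p : γ × ℕ => (p.1, Denumerable.ofNat ℚ p.2) :=
        Computable.fst.pair ((Computable.ofNat ℚ).comp Computable.snd)
      exact neq (hu.comp hp) (hv.comp hp)
    · intro x n
      rw [decide_eq_true_iff, ← h]
      constructor
      · intro hh; rw [hh]; exact Denumerable.encode_ofNat (α := ℚ) n
      · rintro rfl; exact (Denumerable.ofNat_encode (α := ℚ) _).symm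
  exact Computable.encode_iff.1 this

lemma radd {f g : γ → ℚ} (hf : Computable f) (hg : Computable g) :
    Computable fun x => f x + g x := by
  have F : Computable fun p : γ × ℚ => f p.1 := hf.comp Computable.fst
  have G : Computable fun p : γ × ℚ => g p.1 := hg.comp Computable.fst
  have R : Computable fun p : γ × ℚ => p.2 := Computable.snd
  refine graph _
    (fun p => (rp (f p.1) * rd (g p.1) + rp (g p.1) * rd (f p.1)) * rd p.2
      + rn p.2 * (rd (f p.1) * rd (g p.1)))
    (fun p => (rn (f p.1) * rd (g p.1) + rn (g p.1) * rd (f p.1)) * rd p.2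
      + rp p.2 * (rd (f p.1) * rd (g p.1))) ?_ ?_ ?_
  · exact nadd (nmul (nadd (nmul (rp_comp.comp F) (rd_comp.comp G))
      (nmul (rp_comp.comp G) (rd_comp.comp F))) (rd_comp.comp R))
      (nmul (rn_comp.comp R) (nmul (rd_comp.comp F) (rd_comp.comp G)))
  · exact nadd (nmul (nadd (nmul (rn_comp.comp F) (rd_comp.comp G))
      (nmul (rn_comp.comp G) (rd_comp.comp F))) (rd_comp.comp R))
      (nmul (rp_comp.comp R) (nmul (rd_comp.comp F) (rd_comp.comp G)))
  · intro x r
    have h1 := rd_pos (f x)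
    have h2 := rd_pos (g x)
    have h3 := rd_pos r
    conv_lhs => rw [rat_eq (f x), rat_eq (g x), rat_eq r]
    rw [div_add_div _ _ h1.ne' h2.ne', div_eq_div_iff (by positivity) h3.ne', ← @Nat.cast_inj ℚ]
    push_cast
    constructor <;> intro h <;> linarith

lemma rmul {f g : γ → ℚ} (hf : Computable f) (hg : Computable g) :
    Computable fun x => f x * g x := by
  have F : Computable fun p : γ × ℚ => f p.1 := hf.comp Computable.fst
  have G : Computable fun p : γ × ℚ => g p.1 := hg.comp Computable.fst
  have R : Computable fun p : γ × ℚ => p.2 := Computable.snd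
  refine graph _
    (fun p => (rp (f p.1) * rp (g p.1) + rn (f p.1) * rn (g p.1)) * rd p.2
      + rn p.2 * (rd (f p.1) * rd (g p.1)))
    (fun p => (rp (f p.1) * rn (g p.1) + rn (f p.1) * rp (g p.1)) * rd p.2
      + rp p.2 * (rd (f p.1) * rd (g p.1))) ?_ ?_ ?_
  · exact nadd (nmul (nadd (nmul (rp_comp.comp F) (rp_comp.comp G))
      (nmul (rn_comp.comp F) (rn_comp.comp G))) (rd_comp.comp R))
      (nmul (rn_comp.comp R) (nmul (rd_comp.comp F) (rd_comp.comp G)))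
  · exact nadd (nmul (nadd (nmul (rp_comp.comp F) (rn_comp.comp G))
      (nmul (rn_comp.comp F) (rp_comp.comp G))) (rd_comp.comp R))
      (nmul (rp_comp.comp R) (nmul (rd_comp.comp F) (rd_comp.comp G)))
  · intro x r
    have h1 := rd_pos (f x)
    have h2 := rd_pos (g x)
    have h3 := rd_pos r
    conv_lhs => rw [rat_eq (f x), rat_eq (g x), rat_eq r]
    rw [div_mul_div_comm, div_eq_div_iff (by positivity) h3.ne', ← @Nat.cast_inj ℚ]
    push_cast
    constructor <;> intro h <;> linarith

lemma rsub {f g : γ → ℚ} (hf : Computable f) (hg : Computable g) :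
    Computable fun x => f x - g x :=
  (radd hf (rmul (Computable.const (-1)) hg)).of_eq fun x => by ring

lemma rinv {f : γ → ℕ} (hf : Computable f) : Computable fun x => 1 / ((f x : ℚ) + 1) := by
  have F : Computable fun p : γ × ℚ => f p.1 := hf.comp Computable.fst
  have R : Computable fun p : γ × ℚ => p.2 := Computable.snd
  refine graph _
    (fun p => rd p.2 + rn p.2 * (f p.1 + 1)) (fun p => rp p.2 * (f p.1 + 1)) ?_ ?_ ?_
  · exact nadd (rd_comp.comp R) (nmul (rn_comp.comp R) (nadd F (Computable.const 1)))
  · exact nmul (rp_comp.comp R) (nadd F (Computable.const 1))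
  · intro x r
    have h3 := rd_pos r
    conv_lhs => rw [rat_eq r]
    rw [div_eq_div_iff (by positivity) h3.ne', ← @Nat.cast_inj ℚ]
    push_cast
    constructor <;> intro h <;> linarith

lemma rle {f g : γ → ℚ} (hf : Computable f) (hg : Computable g) :
    Computable fun x => decide (f x ≤ g x) := by
  have : Computable fun x => decide (rp (f x) * rd (g x) + rn (g x) * rd (f x) ≤
      rp (g x) * rd (f x) + rn (f x) * rd (g x)) :=
    nle (nadd (nmul (rp_comp.comp hf) (rd_comp.comp hg)) (nmul (rn_comp.comp hg) (rd_comp.comp hf)))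
      (nadd (nmul (rp_comp.comp hg) (rd_comp.comp hf)) (nmul (rn_comp.comp hf) (rd_comp.comp hg)))
  refine this.of_eq fun x => ?_
  rw [decide_eq_decide]
  have h1 := rd_pos (f x)
  have h2 := rd_pos (g x)
  conv_rhs => rw [rat_eq (f x), rat_eq (g x)]
  rw [div_le_div_iff₀ h1 h2, ← @Nat.cast_le ℚ]
  push_cast
  constructor <;> intro h <;> linarith

lemma rmax {f g : γ → ℚ} (hf : Computable f) (hg : Computable g) :
    Computable fun x => max (f x) (g x) := by
  refine (Computable.cond (rle hf hg) hg hf).of_eq fun x => ?_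
  by_cases h : f x ≤ g x
  · simp [h]
  · simp [h, le_of_not_ge h]
end

/-- Running maximum. -/
def runMax (d : ℕ → ℚ) (n : ℕ) : ℚ := Nat.rec (d 0) (fun y IH => max IH (d (y + 1))) n

lemma runMax_comp {d : ℕ → ℚ} (hd : Computable d) : Computable (runMax d) := by
  have h : Computable₂ fun (_ : ℕ) (p : ℕ × ℚ) => max p.2 (d (p.1 + 1)) := by
    have h1 : Computable fun x : ℕ × (ℕ × ℚ) => x.2.2 := Computable.snd.comp Computable.snd
    have h2 : Computable fun x : ℕ × (ℕ × ℚ) => d (x.2.1 + 1) :=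
      hd.comp (Computable.succ.comp (Computable.fst.comp Computable.snd))
    exact rmax h1 h2
  have h0 : Computable fun _ : ℕ => d 0 := Computable.const (d 0)
  exact (Computable.nat_rec Computable.id h0 h).of_eq fun n => rfl

lemma runMax_succ (d : ℕ → ℚ) (n : ℕ) : runMax d (n + 1) = max (runMax d n) (d (n + 1)) := rfl

lemma le_runMax (d : ℕ → ℚ) : ∀ n, d n ≤ runMax d n
  | 0 => le_rfl
  | n + 1 => by rw [runMax_succ]; exact le_max_right _ _

lemma runMax_le (d : ℕ → ℚ) (c : ℝ) (h : ∀ n, (d n : ℝ) ≤ c) : ∀ n, (runMax d n : ℝ) ≤ c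
  | 0 => h 0
  | n + 1 => by
    rw [runMax_succ, Rat.cast_max]
    exact max_le (runMax_le d c h n) (h _)

lemma leftCE_of_le (d : ℕ → ℚ) (hd : Computable d) (c : ℝ) (h : ∀ n, (d n : ℝ) ≤ c)
    (ht : Tendsto (fun n => (d n : ℝ)) atTop (nhds c)) : LeftCE c := by
  refine ⟨fun n => runMax d n - 1 / ((n : ℚ) + 1),
    rsub (runMax_comp hd) (rinv Computable.id), strictMono_nat_of_lt_succ fun n => ?_, ?_⟩
  · have h1 : runMax d n ≤ runMax d (n + 1) := by rw [runMax_succ]; exact le_max_left _ _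
    have h2 : 1 / (((n + 1 : ℕ) : ℚ) + 1) < 1 / ((n : ℚ) + 1) := by
      apply one_div_lt_one_div_of_lt
      · positivity
      · push_cast; linarith
    linarith
  · have h1 : Tendsto (fun n => (runMax d n : ℝ)) atTop (nhds c) :=
      tendsto_of_tendsto_of_tendsto_of_le_of_le ht tendsto_const_nhds
        (fun n => Rat.cast_le.2 (le_runMax d n)) (runMax_le d c h)
    have h2 := h1.sub (tendsto_one_div_add_atTop_nhds_zero_nat (𝕜 := ℝ))
    rw [sub_zero] at h2
    refine h2.congr fun n => ?_
    push_cast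
    rfl

end RatComp

theorem statement10 (α β : ℝ) (hα : LeftCE α) (hβ : LeftCE β) :
    List.TFAE
      [ (∃ q : ℚ, 0 < q ∧ LeftCE ((q : ℝ) * α - β)),
        (∃ q : ℚ, 0 < q ∧ ∃ a b : ℕ → ℚ, Computable a ∧ Computable b ∧
          StrictMono a ∧ StrictMono b ∧
          Tendsto (fun s => (a s : ℝ)) atTop (nhds α) ∧
          Tendsto (fun s => (b s : ℝ)) atTop (nhds β) ∧
          ∀ s, β - (b s : ℝ) < (q : ℝ) * (α - (a s : ℝ))),
        (∃ q : ℚ, 0 < q ∧ ∃ a b : ℕ → ℚ, Computable a ∧ Computable b ∧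
          StrictMono a ∧ StrictMono b ∧
          Tendsto (fun s => (a s : ℝ)) atTop (nhds α) ∧
          Tendsto (fun s => (b s : ℝ)) atTop (nhds β) ∧
          ∀ s, b (s + 1) - b s < q * (a (s + 1) - a s)) ] := by
  tfae_have 1 → 3 := by
    rintro ⟨q, hq, c, hc, cm, ct⟩
    obtain ⟨b, hb, bm, bt⟩ := hβ
    have hq' : (q : ℝ) ≠ 0 := by exact_mod_cast hq.ne'
    have key : ∀ s, q * (q⁻¹ * (b s + c s)) = b s + c s := fun s => by
      rw [← mul_assoc, mul_inv_cancel₀ hq.ne', one_mul]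
    refine ⟨q, hq, fun s => q⁻¹ * (b s + c s), b,
      RatComp.rmul (Computable.const _) (RatComp.radd hb hc), hb, ?_, bm, ?_, bt, ?_⟩
    · intro s t hst
      exact mul_lt_mul_of_pos_left (add_lt_add (bm hst) (cm hst)) (inv_pos.2 hq)
    · have h := (bt.add ct).const_mul ((q : ℝ)⁻¹)
      have e : (q : ℝ)⁻¹ * (β + (q * α - β)) = α := by field_simp; ring
      rw [e] at h
      refine h.congr fun s => ?_
      push_cast
      rfl
    · intro s
      have := cm (Nat.lt_succ_self s)
      rw [mul_sub, key, key]
      linarith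
  tfae_have 3 → 2 := by
    rintro ⟨q, hq, a, b, ha, hb, am, bm, ta, tb, h⟩
    refine ⟨q, hq, a, b, ha, hb, am, bm, ta, tb, fun s => ?_⟩
    have dm : StrictMono fun s => q * a s - b s :=
      strictMono_nat_of_lt_succ fun n => by have := h n; linarith
    have dt : Tendsto (fun s => ((q * a s - b s : ℚ) : ℝ)) atTop (nhds (q * α - β)) := by
      push_cast
      exact (ta.const_mul _).sub tb
    have dm' : Monotone fun s => ((q * a s - b s : ℚ) : ℝ) :=
      fun x y hxy => Rat.cast_le.2 (dm.monotone hxy)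
    have h1 := dm'.ge_of_tendsto dt (s + 1)
    have h2 : ((q * a s - b s : ℚ) : ℝ) < ((q * a (s + 1) - b (s + 1) : ℚ) : ℝ) := by
      exact_mod_cast dm (Nat.lt_succ_self s)
    have h3 := h2.trans_le h1
    push_cast at h3
    linarith
  tfae_have 2 → 1 := by
    rintro ⟨q, hq, a, b, ha, hb, am, bm, ta, tb, h⟩
    refine ⟨q, hq, RatComp.leftCE_of_le (fun s => q * a s - b s)
      (RatComp.rsub (RatComp.rmul (Computable.const _) ha) hb) _ (fun s => ?_) ?_⟩
    · have := h s
      push_cast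
      linarith
    · push_cast
      exact (ta.const_mul _).sub tb
  tfae_finish
end
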